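/- Let $v\in\mathbb{S}^{n-1}$ and let $L\subset\mathbb{R}^{nm}$ be an origin-symmetric convex body. Then $\mathrm{vol}_{nm}((\bar S_v^m L)^\circ) \ge \mathrm{vol}_{nm}(L^\circ)$. -/

import Mathlib

open MeasureTheory RealInnerProductSpace
noncomputable abbrev E (n : ℕ) := EuclideanSpace ℝ (Fin n)

/-- The `m`th-order fiber symmetrization of `L ⊂ (ℝⁿ)ᵐ` in direction `v`. -/
def fiberSym (n m : ℕ) (v : E n) (L : Set (Fin m → E n)) : Set (Fin m → E n) :=
  {z | ∃ x : Fin m → E n, ∃ s₁ s₂ : Fin m → ℝ,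
    (∀ i, ⟪x i, v⟫ = 0) ∧
    (x + fun i => s₁ i • v) ∈ L ∧ (x + fun i => s₂ i • v) ∈ L ∧
    z = x + fun i => ((s₁ i - s₂ i) / 2) • v}

/-- The polar of `L ⊂ (ℝⁿ)ᵐ` with respect to the sum-of-blocks inner product. -/
def polarPi (n m : ℕ) (L : Set (Fin m → E n)) : Set (Fin m → E n) :=
  {x | ∀ y ∈ L, ∑ i, ⟪x i, y i⟫ ≤ 1}

open scoped ENNReal

/-- One-dimensional Brunn–Minkowski, compact version. -/
lemma bm_compact {A B C : Set ℝ} (hA : IsCompact A) (hB : IsCompact B) (hAn : A.Nonempty)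
    (hBn : B.Nonempty) (h : ∀ x ∈ A, ∀ y ∈ B, x + y ∈ C) :
    volume A + volume B ≤ volume C := by
  obtain ⟨a, ha, hamax⟩ := hA.exists_isGreatest hAn
  obtain ⟨b, hb, hbmin⟩ := hB.exists_isLeast hBn
  have h1 : volume ((fun x => x + (-b)) ⁻¹' A) = volume A := measure_preimage_add_right volume (-b) A
  have h2 : volume ((fun x => x + (-a)) ⁻¹' B) = volume B := measure_preimage_add_right volume (-a) B
  have hm : NullMeasurableSet ((fun x => x + (-a)) ⁻¹' B) volume :=
    ((by fun_prop : Measurable fun x : ℝ => x + (-a)) hB.measurableSet).nullMeasurableSet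
  have hd : AEDisjoint volume ((fun x => x + (-b)) ⁻¹' A) ((fun x => x + (-a)) ⁻¹' B) := by
    refine measure_mono_null (t := {a + b}) ?_ (by simp)
    rintro x ⟨hx1, hx2⟩
    have e1 := hamax hx1
    have e2 := hbmin hx2
    simp only [Set.mem_singleton_iff]
    linarith
  rw [← h1, ← h2, ← measure_union₀ hm hd]
  apply measure_mono
  rintro x (hx | hx)
  · have := h _ hx _ hb
    simpa using this
  · have := h _ ha _ hx
    simpa using this

lemma bm_one {A B C : Set ℝ} (hA : MeasurableSet A) (hB : MeasurableSet B) (hAn : A.Nonempty)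
    (hBn : B.Nonempty) (h : ∀ x ∈ A, ∀ y ∈ B, x + y ∈ C) :
    volume A + volume B ≤ volume C := by
  obtain ⟨a, ha⟩ := hAn
  obtain ⟨b, hb⟩ := hBn
  rw [hA.measure_eq_iSup_isCompact, hB.measure_eq_iSup_isCompact]
  have key : ∀ K ⊆ A, IsCompact K → ∀ K' ⊆ B, IsCompact K' → volume K + volume K' ≤ volume C := by
    intro K hK hKc K' hK' hKc'
    calc volume K + volume K' ≤ volume (insert a K) + volume (insert b K') := by
          gcongr <;> exact Set.subset_insert _ _
      _ ≤ volume C := by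
          apply bm_compact (hKc.insert a) (hKc'.insert b) (Set.insert_nonempty _ _)
            (Set.insert_nonempty _ _)
          intro x hx y hy
          exact h x (Set.insert_subset ha hK hx) y (Set.insert_subset hb hK' hy)
  simp only [iSup_and']
  refine ENNReal.biSup_add_biSup_le' (p := fun K => K ⊆ A ∧ IsCompact K)
    (q := fun K => K ⊆ B ∧ IsCompact K) ⟨∅, by simp⟩ ⟨∅, by simp⟩ ?_
  intro K hK K' hK'
  exact key K hK.1 hK.2 K' hK'.1 hK'.2

lemma bm_half {A B C : Set ℝ} (hA : MeasurableSet A) (hB : MeasurableSet B) (hAn : A.Nonempty)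
    (hBn : B.Nonempty) (h : ∀ x ∈ A, ∀ y ∈ B, (1/2 : ℝ) • (x + y) ∈ C) :
    volume A + volume B ≤ 2 * volume C := by
  have := bm_one (C := (fun x => (1/2 : ℝ) • x) ⁻¹' C) hA hB hAn hBn h
  rw [Measure.addHaar_preimage_smul _ (by norm_num)] at this
  simpa using this

lemma layer {f : ℝ → ℝ≥0∞} (hf : Measurable f) :
    ∫⁻ x, f x = ∫⁻ l in Set.Ioi (0:ℝ), volume {x | ENNReal.ofReal l < f x} := by
  have hc : ∀ c : ℝ≥0∞, c = ∫⁻ l in Set.Ioi (0:ℝ), {l | ENNReal.ofReal l < c}.indicator 1 l := by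
    intro c
    have hms : MeasurableSet {l : ℝ | ENNReal.ofReal l < c} :=
      measurableSet_lt ENNReal.measurable_ofReal measurable_const
    rw [lintegral_indicator_one hms, Measure.restrict_apply hms]
    by_cases hct : c = ⊤
    · subst hct
      simp
    · have : {l : ℝ | ENNReal.ofReal l < c} ∩ Set.Ioi 0 = Set.Ioo 0 c.toReal := by
        ext l
        simp only [Set.mem_inter_iff, Set.mem_ofPred_eq, Set.mem_Ioi, Set.mem_Ioo]
        constructor
        · rintro ⟨h1, h2⟩
          exact ⟨h2, (ENNReal.ofReal_lt_iff_lt_toReal h2.le hct).1 h1⟩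
        · rintro ⟨h1, h2⟩
          exact ⟨(ENNReal.ofReal_lt_iff_lt_toReal h1.le hct).2 h2, h1⟩
      rw [this, Real.volume_Ioo, sub_zero, ENNReal.ofReal_toReal hct]
  have hS : MeasurableSet {p : ℝ × ℝ | ENNReal.ofReal p.2 < f p.1} :=
    measurableSet_lt (by fun_prop) (by fun_prop)
  calc ∫⁻ x, f x = ∫⁻ x, ∫⁻ l in Set.Ioi (0:ℝ),
        {p : ℝ × ℝ | ENNReal.ofReal p.2 < f p.1}.indicator 1 (x, l) := by
        congr 1; ext x; exact hc (f x)
    _ = ∫⁻ l in Set.Ioi (0:ℝ), ∫⁻ x,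
        {p : ℝ × ℝ | ENNReal.ofReal p.2 < f p.1}.indicator 1 (x, l) := by
        apply lintegral_lintegral_swap
        exact (measurable_one.indicator hS).aemeasurable
    _ = _ := by
        congr 1; ext l
        have : MeasurableSet {x | ENNReal.ofReal l < f x} := measurableSet_lt (by fun_prop) hf
        rw [← lintegral_indicator_one this]
        rfl

lemma pl_norm {f g h : ℝ → ℝ≥0∞} (hf : Measurable f) (hg : Measurable g) (hh : Measurable h)
    (hfs : ⨆ x, f x = 1) (hgs : ⨆ x, g x = 1)
    (H : ∀ x y, f x * g y ≤ h ((1/2 : ℝ) • (x + y)) ^ 2) :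
    (∫⁻ x, f x) + (∫⁻ x, g x) ≤ 2 * ∫⁻ x, h x := by
  rw [layer hf, layer hg, layer hh, ← lintegral_const_mul' _ _ (by simp)]
  refine (le_lintegral_add _ _).trans (lintegral_mono fun l => ?_)
  by_cases hl : ENNReal.ofReal l < 1
  · apply bm_half (measurableSet_lt measurable_const hf) (measurableSet_lt measurable_const hg)
    · exact lt_iSup_iff.1 (hfs ▸ hl)
    · exact lt_iSup_iff.1 (hgs ▸ hl)
    · intro x hx y hy
      by_contra hc
      have hc : h ((1/2 : ℝ) • (x + y)) ≤ ENNReal.ofReal l := not_lt.1 hc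
      have h1 := (H x y).trans (pow_le_pow_left' hc 2)
      have h2 : ENNReal.ofReal l * ENNReal.ofReal l < f x * g y := ENNReal.mul_lt_mul hx hy
      rw [sq] at h1
      exact absurd h1 (not_le.2 h2)
  · have e1 : {x | ENNReal.ofReal l < f x} = ∅ := by
      ext x
      simp only [Set.mem_ofPred_eq, Set.mem_empty_iff_false, iff_false, not_lt]
      exact ((le_iSup f x).trans hfs.le).trans (not_lt.1 hl)
    have e2 : {x | ENNReal.ofReal l < g x} = ∅ := by
      ext x
      simp only [Set.mem_ofPred_eq, Set.mem_empty_iff_false, iff_false, not_lt]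
      exact ((le_iSup g x).trans hgs.le).trans (not_lt.1 hl)
    rw [e1, e2]
    simp

lemma amgm (p q r : ℝ≥0∞) (h : p + q ≤ 2 * r) : p * q ≤ r ^ 2 := by
  by_cases hr : r = ⊤
  · subst hr
    simp
  have h2 : 2 * r ≠ ⊤ := ENNReal.mul_ne_top (by simp) hr
  have hp : p ≠ ⊤ := ne_top_of_le_ne_top h2 (le_self_add.trans h)
  have hq : q ≠ ⊤ := ne_top_of_le_ne_top h2 (le_add_self.trans h)
  lift p to NNReal using hp
  lift q to NNReal using hq
  lift r to NNReal using hr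
  norm_cast at h ⊢
  have h' : (p : ℝ) + q ≤ 2 * r := by exact_mod_cast h
  have : (p : ℝ) * q ≤ r ^ 2 := by
    nlinarith [sq_nonneg ((p : ℝ) - q), p.coe_nonneg, q.coe_nonneg, r.coe_nonneg]
  exact_mod_cast this

lemma pl_bdd {f g h : ℝ → ℝ≥0∞} (hf : Measurable f) (hg : Measurable g) (hh : Measurable h)
    (hfs : ⨆ x, f x ≠ ⊤) (hgs : ⨆ x, g x ≠ ⊤)
    (H : ∀ x y, f x * g y ≤ h ((1/2 : ℝ) • (x + y)) ^ 2) :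
    (∫⁻ x, f x) * ∫⁻ x, g x ≤ (∫⁻ x, h x) ^ 2 := by
  by_cases ha : ⨆ x, f x = 0
  · have : ∫⁻ x, f x = 0 := by simp [ENNReal.iSup_eq_zero.1 ha]
    simp [this]
  by_cases hb : ⨆ x, g x = 0
  · have : ∫⁻ x, g x = 0 := by simp [ENNReal.iSup_eq_zero.1 hb]
    simp [this]
  obtain ⟨u, hu⟩ : ∃ u, u = (⨆ x, f x)⁻¹ := ⟨_, rfl⟩
  obtain ⟨w, hw⟩ : ∃ w, w = (⨆ x, g x)⁻¹ := ⟨_, rfl⟩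
  have hu0 : u ≠ 0 := by rw [hu]; exact ENNReal.inv_ne_zero.2 hfs
  have hw0 : w ≠ 0 := by rw [hw]; exact ENNReal.inv_ne_zero.2 hgs
  have hut : u ≠ ⊤ := by rw [hu]; exact ENNReal.inv_ne_top.2 ha
  have hwt : w ≠ ⊤ := by rw [hw]; exact ENNReal.inv_ne_top.2 hb
  obtain ⟨k, hk⟩ : ∃ k : ℝ≥0∞, k ^ 2 = u * w := by
    refine ⟨(u * w) ^ (1/2 : ℝ), ?_⟩
    rw [← ENNReal.rpow_natCast, ← ENNReal.rpow_mul]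
    norm_num
  have key := amgm _ _ _ (pl_norm (f := fun x => u * f x) (g := fun x => w * g x)
    (h := fun x => k * h x) (hf.const_mul _) (hg.const_mul _) (hh.const_mul _)
    (by rw [← ENNReal.mul_iSup, hu, ENNReal.inv_mul_cancel ha hfs])
    (by rw [← ENNReal.mul_iSup, hw, ENNReal.inv_mul_cancel hb hgs])
    (by
      intro x y
      rw [mul_pow, hk, mul_mul_mul_comm]
      gcongr
      exact H x y))
  rw [lintegral_const_mul _ hf, lintegral_const_mul _ hg, lintegral_const_mul _ hh, mul_pow, hk,
    mul_mul_mul_comm] at key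
  exact (ENNReal.mul_le_mul_iff_right (mul_ne_zero hu0 hw0) (ENNReal.mul_ne_top hut hwt)).1 key

lemma pl_one {f g h : ℝ → ℝ≥0∞} (hf : Measurable f) (hg : Measurable g) (hh : Measurable h)
    (H : ∀ x y, f x * g y ≤ h ((1/2 : ℝ) • (x + y)) ^ 2) :
    (∫⁻ x, f x) * ∫⁻ x, g x ≤ (∫⁻ x, h x) ^ 2 := by
  have trunc : ∀ {f : ℝ → ℝ≥0∞}, Measurable f →
      ∫⁻ x, f x = ⨆ N : ℕ, ∫⁻ x, min (f x) N := by
    intro f hf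
    rw [← lintegral_iSup (fun N => hf.min measurable_const)]
    · congr 1
      ext x
      rw [← inf_iSup_eq]
      simp [ENNReal.iSup_natCast]
    · intro N N' hN x
      exact min_le_min le_rfl (by exact_mod_cast hN)
  have mono : ∀ f : ℝ → ℝ≥0∞, Monotone fun N : ℕ => ∫⁻ x, min (f x) N := by
    intro f N N' hN
    exact lintegral_mono fun x => min_le_min le_rfl (by exact_mod_cast hN)
  rw [trunc hf, trunc hg, ENNReal.iSup_mul]
  refine iSup_le fun N => ?_
  rw [ENNReal.mul_iSup]
  refine iSup_le fun N' => ?_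
  apply pl_bdd (hf.min measurable_const) (hg.min measurable_const) hh
  · exact ne_top_of_le_ne_top (ENNReal.natCast_ne_top N) (iSup_le fun x => min_le_right _ _)
  · exact ne_top_of_le_ne_top (ENNReal.natCast_ne_top N') (iSup_le fun x => min_le_right _ _)
  · intro x y
    exact le_trans (mul_le_mul' (min_le_left _ _) (min_le_left _ _)) (H x y)

/-- Prékopa–Leindler with weight `1/2`. -/
lemma pl (d : ℕ) : ∀ {f g h : (Fin d → ℝ) → ℝ≥0∞}, Measurable f → Measurable g → Measurable h →
    (∀ x y, f x * g y ≤ h ((1/2 : ℝ) • (x + y)) ^ 2) →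
    (∫⁻ x, f x) * ∫⁻ x, g x ≤ (∫⁻ x, h x) ^ 2 := by
  induction d with
  | zero =>
    intro f g h hf hg hh H
    have hv : (volume : Measure (Fin 0 → ℝ)) = Measure.dirac default := by
      rw [volume_pi, Measure.pi_of_empty _ default]
    rw [hv, lintegral_dirac, lintegral_dirac, lintegral_dirac]
    convert H default default
  | succ d ih =>
    intro f g h hf hg hh H
    let e := MeasurableEquiv.piFinSuccAbove (fun _ : Fin (d + 1) => ℝ) 0
    have he : MeasurePreserving e volume volume :=
      volume_preserving_piFinSuccAbove (fun _ : Fin (d + 1) => ℝ) 0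
    have fub : ∀ {f : (Fin (d + 1) → ℝ) → ℝ≥0∞}, Measurable f →
        ∫⁻ x, f x = ∫⁻ t : ℝ, ∫⁻ y : Fin d → ℝ, f (e.symm (t, y)) := by
      intro f hf
      rw [← (he.symm e).lintegral_comp hf, Measure.volume_eq_prod,
        lintegral_prod (fun a => f (e.symm a)) (hf.comp e.symm.measurable).aemeasurable]
    have meas : ∀ {f : (Fin (d + 1) → ℝ) → ℝ≥0∞}, Measurable f →
        Measurable fun t : ℝ => ∫⁻ y : Fin d → ℝ, f (e.symm (t, y)) := by
      intro f hf
      exact (hf.comp e.symm.measurable).lintegral_prod_right'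
    rw [fub hf, fub hg, fub hh]
    apply pl_one (meas hf) (meas hg) (meas hh)
    intro s t
    have ms : ∀ t : ℝ, Measurable fun y : Fin d → ℝ => e.symm (t, y) := fun t =>
      e.symm.measurable.comp measurable_prodMk_left
    apply ih (hf.comp (ms s)) (hg.comp (ms t)) (hh.comp (ms _))
    intro x y
    have e1 : e.symm ((1/2 : ℝ) • (s + t), (1/2 : ℝ) • (x + y)) =
        (1/2 : ℝ) • (e.symm (s, x) + e.symm (t, y)) := by
      ext i
      refine Fin.cases ?_ (fun j => ?_) i <;> simp [e, MeasurableEquiv.piFinSuccAbove, mul_add]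
    have h1 := H (e.symm (s, x)) (e.symm (t, y))
    rw [← e1] at h1
    exact h1

lemma pl_set (d : ℕ) {A M : Set (Fin d → ℝ)} (hA : MeasurableSet A) (hM : MeasurableSet M)
    (H : ∀ x ∈ A, ∀ y ∈ A, (1/2 : ℝ) • (x - y) ∈ M) : volume A ≤ volume M := by
  have hn : MeasurableSet (-A) := hA.neg
  have key := pl d (f := A.indicator 1) (g := (-A).indicator 1) (h := M.indicator 1)
    (measurable_one.indicator hA) (measurable_one.indicator hn) (measurable_one.indicator hM) (by
      intro x y
      by_cases hx : x ∈ A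
      · by_cases hy : y ∈ -A
        · have := H x hx (-y) hy
          rw [sub_neg_eq_add] at this
          simp only [Set.indicator_of_mem hx, Set.indicator_of_mem hy, Set.indicator_of_mem this]
          simp
        · simp [Set.indicator_of_notMem hy]
      · simp [Set.indicator_of_notMem hx])
  rw [lintegral_indicator_one hA, lintegral_indicator_one hn, lintegral_indicator_one hM,
    Measure.measure_neg, ← sq] at key
  exact (ENNReal.pow_le_pow_left_iff (by norm_num)).1 key

/-- The block-wise orthogonal complement of `v`. -/
def vperp (n m : ℕ) (v : E n) : Submodule ℝ (Fin m → E n) where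
  carrier := {x | ∀ i, ⟪x i, v⟫ = 0}
  add_mem' := by
    intro a b ha hb i
    simp [inner_add_left, ha i, hb i]
  zero_mem' := by intro i; simp
  smul_mem' := by
    intro c a ha i
    simp [inner_smul_left, ha i]

lemma exists_decomp (n m : ℕ) (v : E n) (hv : ‖v‖ = 1) :
    ∃ (d : ℕ) (e : (Fin d → ℝ) →ₗ[ℝ] (Fin m → E n))
      (Φ : ((Fin m → ℝ) × (Fin d → ℝ)) ≃ₗ[ℝ] (Fin m → E n)),
      (∀ y i, ⟪e y i, v⟫ = 0) ∧ ∀ t y, Φ (t, y) = e y + fun i => t i • v := by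
  have hvv : ⟪v, v⟫ = 1 := by rw [real_inner_self_eq_norm_sq, hv]; norm_num
  let b := Module.finBasis ℝ (vperp n m v)
  let e := (vperp n m v).subtype ∘ₗ b.equivFun.symm.toLinearMap
  have he : ∀ y i, ⟪e y i, v⟫ = 0 := fun y i => (b.equivFun.symm y).2 i
  let T : (Fin m → ℝ) →ₗ[ℝ] (Fin m → E n) :=
    LinearMap.pi fun i => (LinearMap.toSpanSingleton ℝ (E n) v) ∘ₗ LinearMap.proj i
  have hT : ∀ t, T t = fun i => t i • v := by
    intro t
    rfl
  let φ : ((Fin m → ℝ) × (Fin (Module.finrank ℝ (vperp n m v)) → ℝ)) →ₗ[ℝ] (Fin m → E n) :=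
    T.coprod e
  have hφ : ∀ t y, φ (t, y) = e y + fun i => t i • v := by
    intro t y
    rw [LinearMap.coprod_apply, hT, add_comm]
  refine ⟨_, e, LinearEquiv.ofBijective φ ⟨?_, ?_⟩, he, fun t y => hφ t y⟩
  · rw [← LinearMap.ker_eq_bot, LinearMap.ker_eq_bot']
    rintro ⟨t, y⟩ h
    rw [hφ] at h
    have ht : t = 0 := by
      ext i
      have := congrArg (fun z => ⟪z i, v⟫) h
      simpa [inner_add_left, inner_smul_left, he, hvv, hv] using this
    subst ht
    have hy : e y = 0 := by
      rw [← h]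
      ext i
      simp
    have : y = 0 := by
      have h1 : b.equivFun.symm y = 0 := Subtype.ext hy
      exact (LinearEquiv.map_eq_zero_iff _).1 h1
    rw [this]
    rfl
  · intro z
    let w : vperp n m v := ⟨fun i => z i - ⟪z i, v⟫ • v, by
      intro i
      simp [inner_sub_left, inner_smul_left, hvv, hv]⟩
    refine ⟨(fun i => ⟪z i, v⟫, b.equivFun w), ?_⟩
    rw [hφ]
    have : e (b.equivFun w) = w := by
      simp only [e, LinearMap.comp_apply, LinearEquiv.coe_coe, LinearEquiv.symm_apply_apply]
      rfl
    rw [this]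
    ext i
    simp [w]

lemma polar_closed (n m : ℕ) (L : Set (Fin m → E n)) : IsClosed (polarPi n m L) := by
  have : polarPi n m L = ⋂ y ∈ L, {x | ∑ i, ⟪x i, y i⟫ ≤ 1} := by
    ext x
    simp [polarPi]
  rw [this]
  exact isClosed_biInter fun y _ => isClosed_le (by fun_prop) continuous_const

theorem stmt12 (n m : ℕ) (hm : 1 ≤ m) (v : E n) (hv : ‖v‖ = 1)
    (L : Set (Fin m → E n)) (hLcpt : IsCompact L) (hLcvx : Convex ℝ L)
    (hLint : (interior L).Nonempty) (hLsym : L = -L) :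
    volume (polarPi n m L) ≤ volume (polarPi n m (fiberSym n m v L)) := by
  obtain ⟨d, e, Φ, he, hΦ⟩ := exists_decomp n m v hv
  have hvv : ⟪v, v⟫ = 1 := by rw [real_inner_self_eq_norm_sq, hv]; norm_num
  let Ψ := Φ.toContinuousLinearEquiv
  have hΨ : ∀ t y, Ψ (t, y) = e y + fun i => t i • v := hΦ
  have hK := polar_closed n m L
  have hM := polar_closed n m (fiberSym n m v L)
  set K := polarPi n m L with hKdef
  set M := polarPi n m (fiberSym n m v L) with hMdef
  have hKs : ∀ x ∈ K, -x ∈ K := by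
    intro x hx y hy
    have hy' : -y ∈ L := by
      rw [hLsym] at hy
      exact hy
    have := hx (-y) hy'
    simpa using this
  have main : (volume : Measure ((Fin m → ℝ) × (Fin d → ℝ))) (Ψ ⁻¹' K) ≤ volume (Ψ ⁻¹' M) := by
    have mK : MeasurableSet (Ψ ⁻¹' K) := (hK.preimage Ψ.continuous).measurableSet
    have mM : MeasurableSet (Ψ ⁻¹' M) := (hM.preimage Ψ.continuous).measurableSet
    rw [Measure.volume_eq_prod, Measure.prod_apply mK, Measure.prod_apply mM]
    refine lintegral_mono fun t => ?_
    apply pl_set d (measurable_prodMk_left mK) (measurable_prodMk_left mM)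
    intro y₁ h₁ y₂ h₂ z hz
    obtain ⟨x, s₁, s₂, hx, hs₁, hs₂, rfl⟩ := hz
    have h₁ : Ψ (t, y₁) ∈ K := h₁
    have h₂ : Ψ (t, y₂) ∈ K := h₂
    have k₁ := h₁ _ hs₁
    have k₂ := hKs _ h₂ _ hs₂
    rw [hΨ] at k₁ k₂
    have hx' : ∀ i, ⟪v, x i⟫ = 0 := fun i => by rw [real_inner_comm]; exact hx i
    have eq : ∑ i, ⟪Ψ (t, (1/2 : ℝ) • (y₁ - y₂)) i,
        (x + fun i => ((s₁ i - s₂ i) / 2) • v) i⟫ =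
        ((∑ i, ⟪(e y₁ + fun i => t i • v) i, (x + fun i => s₁ i • v) i⟫) +
        ∑ i, ⟪(-(e y₂ + fun i => t i • v)) i, (x + fun i => s₂ i • v) i⟫) / 2 := by
      rw [← Finset.sum_add_distrib, Finset.sum_div, hΨ]
      refine Finset.sum_congr rfl fun i _ => ?_
      simp only [Pi.add_apply, Pi.neg_apply, inner_add_left, inner_add_right, inner_neg_left,
        inner_smul_left, inner_smul_right, he, hx', hvv, map_smul, map_sub, Pi.smul_apply,
        Pi.sub_apply, inner_sub_left, conj_trivial]
      ring
    refine eq.le.trans ?_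
    linarith
  let μ : Measure ((Fin m → ℝ) × (Fin d → ℝ)) := Measure.map Ψ.symm volume
  have i1 : (volume : Measure ((Fin m → ℝ) × (Fin d → ℝ))).IsAddHaarMeasure := by
    have j1 : ∀ k : ℕ, (volume : Measure (Fin k → ℝ)).IsAddHaarMeasure := by
      intro k
      rw [volume_pi]
      infer_instance
    have := j1 m
    have := j1 d
    rw [Measure.volume_eq_prod]
    infer_instance
  have i2 : (volume : Measure (Fin m → E n)).IsAddHaarMeasure := by
    rw [volume_pi]
    infer_instance
  have i3 : μ.IsAddHaarMeasure := Ψ.symm.isAddHaarMeasure_map volume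
  have hμ : μ = Measure.addHaarScalarFactor μ volume • (volume : Measure _) :=
    Measure.isAddLeftInvariant_eq_smul μ volume
  have conv : ∀ S : Set (Fin m → E n), IsClosed S → volume S = μ (Ψ ⁻¹' S) := by
    intro S hS
    rw [Measure.map_apply Ψ.symm.continuous.measurable (hS.preimage Ψ.continuous).measurableSet,
      ← Set.preimage_comp]
    congr 1
    ext x
    simp
  rw [conv K hK, conv M hM, hμ]
  simp only [Measure.smul_apply]
  gcongr
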